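/- Let p, q be positive integers and let C(1), …, C(q) be selfadjoint (Hermitian) p×p complex matrices that are linearly independent over ℝ and whose real linear span contains a positive definite matrix; let b(1), …, b(q) be real numbers. Then there exists a positive semidefinite matrix X ∈ M_p(ℂ) with tr(C(ι)·X) = b(ι) for all ι = 1, …, q if and only if for every x ∈ ℝ^q such that Σ_{ι=1}^q x(ι)·C(ι) is positive semidefinite one has Σ_{ι=1}^q b(ι)·x(ι) ≥ 0. -/

import Mathlib

open scoped Matrix ComplexOrder

namespace Matrix

variable {n : Type*}

variable (n) in
/-- The cone of complex matrices whose Hermitian part is positive semidefinite. -/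
def accretiveCone : PointedCone ℝ (Matrix n n ℂ) where
  carrier := {A | (A + Aᴴ).PosSemidef}
  add_mem' {A B} hA hB := by
    simpa [add_add_add_comm] using PosSemidef.add hA hB
  zero_mem' := by simpa using PosSemidef.zero
  smul_mem' c A hA := by
    have h : (c : ℝ) • A + ((c : ℝ) • A)ᴴ = (c : ℝ) • (A + Aᴴ) := by
      rw [conjTranspose_smul, star_trivial, smul_add]
    change ((c : ℝ) • A + ((c : ℝ) • A)ᴴ).PosSemidef
    rw [h]
    exact PosSemidef.smul hA c.2

lemma mem_accretiveCone {A : Matrix n n ℂ} : A ∈ accretiveCone n ↔ (A + Aᴴ).PosSemidef := Iff.rfl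

lemma IsHermitian.mem_accretiveCone_iff {A : Matrix n n ℂ} (hA : A.IsHermitian) :
    A ∈ accretiveCone n ↔ A.PosSemidef := by
  rw [mem_accretiveCone, hA.eq]
  refine ⟨fun h ↦ ?_, fun h ↦ h.add h⟩
  have := h.smul (show (0 : ℝ) ≤ 1 / 2 by norm_num)
  rwa [← two_smul ℝ A, smul_smul, one_div, inv_mul_cancel₀ two_ne_zero, one_smul] at this

variable [Fintype n]

lemma PosSemidef.trace_mul_nonneg {A B : Matrix n n ℂ} (hA : A.PosSemidef) (hB : B.PosSemidef) :
    0 ≤ (A * B).trace := by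
  classical
  open scoped MatrixOrder Matrix.Norms.L2Operator in
  obtain ⟨S, rfl⟩ := CStarAlgebra.nonneg_iff_eq_star_mul_self.mp hB.nonneg
  rw [star_eq_conjTranspose, ← mul_assoc, trace_mul_comm, ← mul_assoc]
  exact (hA.mul_mul_conjTranspose_same S).trace_nonneg

open scoped MatrixOrder Matrix.Norms.L2Operator in
/-- A positive definite matrix is an order unit for the Hermitian matrices. -/
lemma PosDef.exists_posSemidef_smul_add {D H : Matrix n n ℂ} (hD : D.PosDef)
    (hH : H.IsHermitian) : ∃ t : ℝ, (t • D + H).PosSemidef := by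
  classical
  rcases isEmpty_or_nonempty n with _ | _
  · exact ⟨0, by simpa [Subsingleton.elim H 0] using PosSemidef.zero⟩
  obtain ⟨r, hr, hrD⟩ := (CFC.exists_pos_algebraMap_le_iff (A := Matrix n n ℂ)
    hD.isHermitian.isSelfAdjoint).mpr
    fun _ hx ↦ (isStrictlyPositive_iff_posDef.mpr hD).spectrum_pos hx
  refine ⟨‖H‖ / r, nonneg_iff_posSemidef.mp ?_⟩
  have hnorm := hH.isSelfAdjoint.neg_algebraMap_norm_le_self
  have hscale : algebraMap ℝ (Matrix n n ℂ) ‖H‖ ≤ (‖H‖ / r) • D := by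
    calc algebraMap ℝ (Matrix n n ℂ) ‖H‖ = (‖H‖ / r) • algebraMap ℝ (Matrix n n ℂ) r := by
          rw [Algebra.algebraMap_eq_smul_one, Algebra.algebraMap_eq_smul_one, smul_smul,
            div_mul_cancel₀ _ hr.ne']
      _ ≤ _ := smul_le_smul_of_nonneg_left hrD (by positivity)
  calc (0 : Matrix n n ℂ) = algebraMap ℝ (Matrix n n ℂ) ‖H‖ + -algebraMap ℝ (Matrix n n ℂ) ‖H‖ :=
        (add_neg_cancel _).symm
    _ ≤ _ := add_le_add hscale hnorm

/-- Every linear functional on square matrices is of the form `A ↦ tr (A * X)`. -/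
lemma exists_trace_mul_eq (G : Matrix n n ℂ →ₗ[ℂ] ℂ) :
    ∃ X : Matrix n n ℂ, ∀ A, (A * X).trace = G A := by
  classical
  refine ⟨of fun j i ↦ G (single i j 1), fun A ↦ ?_⟩
  conv_rhs => rw [matrix_eq_sum_single A]
  simp only [map_sum, trace, diag, mul_apply, of_apply]
  refine Finset.sum_congr rfl fun i _ ↦ Finset.sum_congr rfl fun j _ ↦ ?_
  rw [← smul_eq_mul, ← map_smul, smul_single, smul_eq_mul, mul_one]

/-- A real functional that is nonnegative on `accretiveCone` is represented on Hermitian matrices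
by a positive semidefinite matrix. -/
lemma exists_posSemidef_trace_mul_eq {g : Matrix n n ℂ →ₗ[ℝ] ℝ}
    (hg : ∀ A ∈ accretiveCone n, 0 ≤ g A) :
    ∃ X : Matrix n n ℂ, X.PosSemidef ∧ ∀ A : Matrix n n ℂ, A.IsHermitian →
      (A * X).trace = (g A : ℂ) := by
  have hskew (A : Matrix n n ℂ) (hA : Aᴴ = -A) : g A = 0 := by
    refine le_antisymm ?_ (hg A ?_)
    · have := hg (-A) (by simpa [mem_accretiveCone, hA] using PosSemidef.zero)
      simpa using this
    · simpa [mem_accretiveCone, hA] using PosSemidef.zero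
  obtain ⟨Y, hY⟩ := exists_trace_mul_eq (Module.Dual.extendRCLike (𝕜 := ℂ) g)
  have hYg (A : Matrix n n ℂ) (hA : A.IsHermitian) : (A * Y).trace = (g A : ℂ) := by
    rw [hY, Module.Dual.extendRCLike_apply, hskew ((RCLike.I : ℂ) • A) (by simp [hA.eq])]
    simp
  have hYg' (A : Matrix n n ℂ) (hA : A.IsHermitian) : (A * Yᴴ).trace = (g A : ℂ) := by
    rw [← hA.eq, ← conjTranspose_mul, trace_conjTranspose, trace_mul_comm, hYg A hA, hA.eq]
    simp
  have htr (A : Matrix n n ℂ) (hA : A.IsHermitian) :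
      (A * ((1 / 2 : ℝ) • (Y + Yᴴ))).trace = (g A : ℂ) := by
    rw [Matrix.mul_smul, mul_add, trace_smul, trace_add, hYg A hA, hYg' A hA, Complex.real_smul]
    push_cast
    ring
  refine ⟨(1 / 2 : ℝ) • (Y + Yᴴ), .of_dotProduct_mulVec_nonneg ?_ fun v ↦ ?_, htr⟩
  · rw [IsHermitian, conjTranspose_smul, star_trivial, (isHermitian_add_transpose_self Y).eq]
  · have hv := posSemidef_vecMulVec_self_star v
    have h := htr _ hv.isHermitian
    rw [trace_mul_comm, mul_vecMulVec, trace_vecMulVec, dotProduct_comm] at h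
    rw [h]
    exact Complex.zero_le_real.mpr (hg _ (hv.isHermitian.mem_accretiveCone_iff.mpr hv))

end Matrix

theorem psd_solution_iff_nonneg_functional {p q : ℕ} (hp : 0 < p) (hq : 0 < q)
    (C : Fin q → Matrix (Fin p) (Fin p) ℂ) (hC : ∀ ι, (C ι).IsHermitian)
    (hind : LinearIndependent ℝ C)
    (hspan : ∃ D : Matrix (Fin p) (Fin p) ℂ,
      D ∈ Submodule.span ℝ (Set.range C) ∧ D.PosDef)
    (b : Fin q → ℝ) :
    (∃ X : Matrix (Fin p) (Fin p) ℂ, X.PosSemidef ∧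
        ∀ ι, Matrix.trace (C ι * X) = (b ι : ℂ)) ↔
      ∀ x : Fin q → ℝ, (∑ ι, x ι • C ι).PosSemidef → 0 ≤ ∑ ι, b ι * x ι := by
  constructor
  · rintro ⟨X, hX, hXb⟩ x hx
    have h := hx.trace_mul_nonneg hX
    have hsum : ((∑ ι, x ι • C ι) * X).trace = ((∑ ι, b ι * x ι : ℝ) : ℂ) := by
      simp [Finset.sum_mul, Matrix.trace_sum, hXb, mul_comm]
    rw [hsum] at h
    exact Complex.zero_le_real.mp h
  · intro hb
    let f : Matrix (Fin p) (Fin p) ℂ →ₗ.[ℝ] ℝ :=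
      ⟨Submodule.span ℝ (Set.range C), (Module.Basis.span hind).constr ℝ b⟩
    have hf (x : Fin q → ℝ) (y : f.domain) (hy : ∑ ι, x ι • C ι = y) :
        f y = ∑ ι, b ι * x ι := by
      have : y = ∑ ι, x ι • Module.Basis.span hind ι := by
        ext1
        rw [← hy, Submodule.coe_sum]
        exact Finset.sum_congr rfl fun ι _ ↦ by
          rw [Submodule.coe_smul, Module.Basis.span_apply]
      change (Module.Basis.span hind).constr ℝ b y = _
      rw [this]
      simp only [map_sum, map_smul, Module.Basis.constr_basis, smul_eq_mul, mul_comm]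
    have hherm (x : Fin q → ℝ) : (∑ ι, x ι • C ι).IsHermitian := by
      simp [Matrix.IsHermitian, Matrix.conjTranspose_sum, Matrix.conjTranspose_smul, (hC _).eq]
    obtain ⟨D, hDmem, hD⟩ := hspan
    obtain ⟨g, hgf, hg⟩ := riesz_extension (Matrix.accretiveCone (Fin p)) f
      (fun y hy ↦ by
        obtain ⟨x, hx⟩ := (Submodule.mem_span_range_iff_exists_fun ℝ).mp y.2
        rw [hf x y hx]
        rw [← hx, (hherm x).mem_accretiveCone_iff] at hy
        exact hb x hy)
      (fun Y ↦ by
        obtain ⟨t, ht⟩ := hD.exists_posSemidef_smul_add (Matrix.isHermitian_add_transpose_self Y)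
        refine ⟨⟨(t / 2) • D, Submodule.smul_mem _ _ hDmem⟩, ?_⟩
        rw [Matrix.mem_accretiveCone]
        convert ht using 1
        simp only [Matrix.conjTranspose_add, Matrix.conjTranspose_smul, hD.isHermitian.eq,
          star_trivial]
        module)
    obtain ⟨X, hX, hXg⟩ := Matrix.exists_posSemidef_trace_mul_eq hg
    refine ⟨X, hX, fun ι ↦ ?_⟩
    rw [hXg _ (hC ι)]
    have h₁ := hgf ⟨C ι, Submodule.subset_span ⟨ι, rfl⟩⟩
    rw [hf (Pi.single ι 1) _ (by simp [Pi.single_apply, ite_smul])] at h₁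
    simpa [Pi.single_apply] using h₁
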